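/- arXiv:2312.16543 — 2 statements merged into one kernel-verified Lean document; each statement's English description precedes it below -/
import Mathlib

section
/- Let (J, ·, α) be a multiplicative Hom-Jordan superalgebra and let R : J → J be a Rota-Baxter operator of weight zero on J. Then the product x ∘ y = R(x) · y (for homogeneous x, y ∈ J) defines a Hom-pre-Jordan superalgebra structure (J, ∘, α). -/
open scoped TensorProduct

noncomputable section

/-- The sign `(-1)^e` attached to a parity `e : ZMod 2`. -/
def gsign (K : Type*) [Field K] (e : ZMod 2) : K := (-1 : K) ^ e.val

variable {K : Type*} [Field K] [CharZero K]
variable {J V : Type*} [AddCommGroup J] [Module K J] [AddCommGroup V] [Module K V]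

/-- An even bilinear map with respect to a `ZMod 2`-grading. -/
def EvenBilin (g : ZMod 2 → Submodule K J) (m : J →ₗ[K] J →ₗ[K] J) : Prop :=
  ∀ i j : ZMod 2, ∀ x ∈ g i, ∀ y ∈ g j, m x y ∈ g (i + j)

/-- An even linear map with respect to a `ZMod 2`-grading. -/
def EvenMap (g : ZMod 2 → Submodule K J) (α : J →ₗ[K] J) : Prop :=
  ∀ i : ZMod 2, ∀ x ∈ g i, α x ∈ g i

/-- Super-commutativity `x·y = (-1)^{|x||y|} y·x` on homogeneous elements. -/
def SuperComm (g : ZMod 2 → Submodule K J) (m : J →ₗ[K] J →ₗ[K] J) : Prop :=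
  ∀ i j : ZMod 2, ∀ x ∈ g i, ∀ y ∈ g j, m x y = gsign K (i * j) • m y x

/-- The Hom-associator `as_α(x,y,z) = (x·y)·α(z) − α(x)·(y·z)`. -/
def hAss (m : J →ₗ[K] J →ₗ[K] J) (α : J →ₗ[K] J) (x y z : J) : J :=
  m (m x y) (α z) - m (α x) (m y z)

/-- The Hom-Jordan super-identity: the cyclic sum over `(x,y,u)` of
`(-1)^{|u|(|x|+|z|)} as_α(x·y, α(z), α(u))` vanishes. -/
def HomJordanId (g : ZMod 2 → Submodule K J) (m : J →ₗ[K] J →ₗ[K] J) (α : J →ₗ[K] J) : Prop :=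
  ∀ px py pz pu : ZMod 2, ∀ x ∈ g px, ∀ y ∈ g py, ∀ z ∈ g pz, ∀ u ∈ g pu,
      gsign K (pu * (px + pz)) • hAss m α (m x y) (α z) (α u)
    + gsign K (px * (py + pz)) • hAss m α (m y u) (α z) (α x)
    + gsign K (py * (pu + pz)) • hAss m α (m u x) (α z) (α y) = 0

/-- Hom-Jordan superalgebra. -/
def IsHomJordan (g : ZMod 2 → Submodule K J) (m : J →ₗ[K] J →ₗ[K] J) (α : J →ₗ[K] J) : Prop :=
  EvenBilin g m ∧ EvenMap g α ∧ SuperComm g m ∧ HomJordanId g m α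

/-- `α` is multiplicative with respect to `m`. -/
def IsMult (m : J →ₗ[K] J →ₗ[K] J) (α : J →ₗ[K] J) : Prop :=
  ∀ x y : J, α (m x y) = m (α x) (α y)

/-- Multiplicative Hom-Jordan superalgebra. -/
def IsMultHomJordan (g : ZMod 2 → Submodule K J) (m : J →ₗ[K] J →ₗ[K] J) (α : J →ₗ[K] J) :
    Prop :=
  IsHomJordan g m α ∧ IsMult m α

/-- Evenness of a representation map. -/
def EvenRepMap (g : ZMod 2 → Submodule K J) (gV : ZMod 2 → Submodule K V)
    (π : J →ₗ[K] Module.End K V) : Prop :=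
  ∀ i j : ZMod 2, ∀ x ∈ g i, ∀ v ∈ gV j, π x v ∈ gV (i + j)

/-- Representation (module) of a Hom-Jordan superalgebra. -/
def IsRep (g : ZMod 2 → Submodule K J) (m : J →ₗ[K] J →ₗ[K] J) (α : J →ₗ[K] J)
    (gV : ZMod 2 → Submodule K V) (π : J →ₗ[K] Module.End K V) (β : Module.End K V) : Prop :=
  EvenRepMap g gV π ∧ (∀ i : ZMod 2, ∀ v ∈ gV i, β v ∈ gV i) ∧
  (∀ x : J, β * π x = π (α x) * β) ∧
  (∀ px py pz : ZMod 2, ∀ x ∈ g px, ∀ y ∈ g py, ∀ z ∈ g pz,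
      gsign K (px * pz) • (π (m (α x) (α y)) * π (α z) * β)
    + gsign K (px * py) • (π (m (α y) (α z)) * π (α x) * β)
    + gsign K (py * pz) • (π (m (α z) (α x)) * π (α y) * β)
    = gsign K (px * pz) • (π (α (α x)) * π (m y z) * β)
    + gsign K (px * py) • (π (α (α y)) * π (m z x) * β)
    + gsign K (py * pz) • (π (α (α z)) * π (m x y) * β)) ∧
  (∀ px py pz : ZMod 2, ∀ x ∈ g px, ∀ y ∈ g py, ∀ z ∈ g pz,
      gsign K (px * pz) • (π (m (α x) (α y)) * π (α z) * β)
    + gsign K (px * py) • (π (m (α y) (α z)) * π (α x) * β)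
    + gsign K (py * pz) • (π (m (α z) (α x)) * π (α y) * β)
    = gsign K (px * pz) • (π (α (α x)) * π (α y) * π z)
    + gsign K (px * py + py * pz) • (π (α (α z)) * π (α y) * π x)
    + gsign K (py * pz + px * pz) • (π (m (m x z) (α y)) * (β * β)))

/-- O-operator on `J` associated to the representation `(V, π, β)`. -/
def IsOOperator (g : ZMod 2 → Submodule K J) (m : J →ₗ[K] J →ₗ[K] J) (α : J →ₗ[K] J)
    (gV : ZMod 2 → Submodule K V) (π : J →ₗ[K] Module.End K V) (β : Module.End K V)
    (T : V →ₗ[K] J) : Prop :=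
  (∀ i : ZMod 2, ∀ v ∈ gV i, T v ∈ g i) ∧
  (∀ v : V, α (T v) = T (β v)) ∧
  (∀ i j : ZMod 2, ∀ u ∈ gV i, ∀ v ∈ gV j,
    m (T u) (T v) = T (π (T u) v + gsign K (i * j) • π (T v) u))

/-- The grading on a direct sum `J ⊕ V`. -/
def prodGrading (g : ZMod 2 → Submodule K J) (gV : ZMod 2 → Submodule K V) :
    ZMod 2 → Submodule K (J × V) := fun i => (g i).prod (gV i)

/-- The semidirect product multiplication, determined on homogeneous elements. -/
def IsSemidirectMul (g : ZMod 2 → Submodule K J) (gV : ZMod 2 → Submodule K V)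
    (m : J →ₗ[K] J →ₗ[K] J) (π : J →ₗ[K] Module.End K V)
    (m' : (J × V) →ₗ[K] (J × V) →ₗ[K] (J × V)) : Prop :=
  ∀ i j : ZMod 2, ∀ x ∈ g i, ∀ u ∈ gV i, ∀ y ∈ g j, ∀ v ∈ gV j,
    m' (x, u) (y, v) = (m x y, π x v + gsign K (i * j) • π y u)

/-- The induced grading on the linear dual. -/
def dualGrading (gV : ZMod 2 → Submodule K V) (i : ZMod 2) :
    Submodule K (Module.Dual K V) where
  carrier := {ξ | ∀ x ∈ gV (i + 1), ξ x = 0}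
  add_mem' := by
    intro a b ha hb x hx
    simp [ha x hx, hb x hx]
  zero_mem' := by
    intro x hx
    simp
  smul_mem' := by
    intro c a ha x hx
    simp [ha x hx]

/-- Nijenhuis operator on a Hom-Jordan superalgebra. -/
def IsNijenhuis (gA : ZMod 2 → Submodule K J) (mA : J →ₗ[K] J →ₗ[K] J)
    (γ N : J →ₗ[K] J) : Prop :=
  EvenMap gA N ∧ N ∘ₗ γ = γ ∘ₗ N ∧
  ∀ x y : J, mA (N x) (N y) = N (mA (N x) y + mA x (N y) - N (mA x y))

/-- The super-symmetrized product `x·y = x∘y + (-1)^{|x||y|} y∘x` on homogeneous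
elements of parities `i`, `j`. -/
def sMul (c : J →ₗ[K] J →ₗ[K] J) (i j : ZMod 2) (x y : J) : J :=
  c x y + gsign K (i * j) • c y x

/-- Hom-pre-Jordan superalgebra. -/
def IsHomPreJordan (g : ZMod 2 → Submodule K J) (c : J →ₗ[K] J →ₗ[K] J) (α : J →ₗ[K] J) :
    Prop :=
  EvenBilin g c ∧ EvenMap g α ∧ IsMult c α ∧
  (∀ px py pz pu : ZMod 2, ∀ x ∈ g px, ∀ y ∈ g py, ∀ z ∈ g pz, ∀ u ∈ g pu,
      c (sMul c px py (α x) (α y)) (c (α z) (α u))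
    + gsign K (px * (py + pz)) • c (sMul c py pz (α y) (α z)) (c (α x) (α u))
    + gsign K (pz * (px + py)) • c (sMul c pz px (α z) (α x)) (c (α y) (α u))
    = c (α (α x)) (c (sMul c py pz y z) (α u))
    + gsign K (px * (py + pz)) • c (α (α y)) (c (sMul c pz px z x) (α u))
    + gsign K (pz * (px + py)) • c (α (α z)) (c (sMul c px py x y) (α u))) ∧
  (∀ px py pz pu : ZMod 2, ∀ x ∈ g px, ∀ y ∈ g py, ∀ z ∈ g pz, ∀ u ∈ g pu,
      c (α (α x)) (c (α y) (c z u))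
    + gsign K (pz * (px + py) + px * py) • c (α (α z)) (c (α y) (c x u))
    + gsign K (py * pz) • c (sMul c (px + pz) py (sMul c px pz x z) (α y)) (α (α u))
    = c (α (α x)) (c (sMul c py pz y z) (α u))
    + gsign K (px * (py + pz)) • c (α (α y)) (c (sMul c pz px z x) (α u))
    + gsign K (pz * (px + py)) • c (α (α z)) (c (sMul c px py x y) (α u)))

/-- Hom-dendriform superalgebra, with `p = ≺` and `s = ≻`. -/
def IsHomDendriform (g : ZMod 2 → Submodule K J)
    (p s : J →ₗ[K] J →ₗ[K] J) (α : J →ₗ[K] J) : Prop :=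
  EvenBilin g p ∧ EvenBilin g s ∧ EvenMap g α ∧ IsMult p α ∧ IsMult s α ∧
  (∀ x y z : J, s (α x) (s y z) = s (p x y + s x y) (α z)) ∧
  (∀ x y z : J, p (p x y) (α z) = p (α x) (p y z + s y z)) ∧
  (∀ x y z : J, p (s x y) (α z) = s (α x) (p y z))

/-- Hom-alternative superalgebra. -/
def IsHomAlternative (g : ZMod 2 → Submodule K J) (m : J →ₗ[K] J →ₗ[K] J)
    (α : J →ₗ[K] J) : Prop :=
  EvenBilin g m ∧ EvenMap g α ∧
  (∀ i j : ZMod 2, ∀ x ∈ g i, ∀ y ∈ g j, ∀ z : J,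
    hAss m α x y z = -(gsign K (i * j) • hAss m α y x z)) ∧
  (∀ j k : ZMod 2, ∀ y ∈ g j, ∀ z ∈ g k, ∀ x : J,
    hAss m α x y z = -(gsign K (j * k) • hAss m α x z y))

/-- `ass_l` for a Hom-pre-alternative superalgebra, `p = ≺`, `s = ≻`. -/
def passL (p s : J →ₗ[K] J →ₗ[K] J) (α : J →ₗ[K] J) (x y z : J) : J :=
  s (p x y + s x y) (α z) - s (α x) (s y z)

/-- `ass_m` for a Hom-pre-alternative superalgebra. -/
def passM (p s : J →ₗ[K] J →ₗ[K] J) (α : J →ₗ[K] J) (x y z : J) : J :=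
  p (s x y) (α z) - s (α x) (p y z)

/-- `ass_r` for a Hom-pre-alternative superalgebra. -/
def passR (p s : J →ₗ[K] J →ₗ[K] J) (α : J →ₗ[K] J) (x y z : J) : J :=
  p (p x y) (α z) - p (α x) (p y z + s y z)

/-- Hom-pre-alternative superalgebra. -/
def IsHomPreAlternative (g : ZMod 2 → Submodule K J)
    (p s : J →ₗ[K] J →ₗ[K] J) (α : J →ₗ[K] J) : Prop :=
  EvenBilin g p ∧ EvenBilin g s ∧ EvenMap g α ∧
  (∀ i j : ZMod 2, ∀ x ∈ g i, ∀ y ∈ g j, ∀ z : J,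
    passM p s α x y z + gsign K (i * j) • passR p s α y x z = 0) ∧
  (∀ j k : ZMod 2, ∀ y ∈ g j, ∀ z ∈ g k, ∀ x : J,
    passM p s α x y z + gsign K (j * k) • passL p s α x z y = 0) ∧
  (∀ i j : ZMod 2, ∀ x ∈ g i, ∀ y ∈ g j, ∀ z : J,
    passL p s α x y z + gsign K (i * j) • passL p s α y x z = 0) ∧
  (∀ j k : ZMod 2, ∀ y ∈ g j, ∀ z ∈ g k, ∀ x : J,
    passR p s α x y z + gsign K (j * k) • passR p s α x z y = 0)

/-- `r = Σ Xₗ ⊗ Yₗ` (with `Xₗ, Yₗ` homogeneous of parities `Pₗ, Qₗ`) is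
super skew-symmetric: `σ(r) = -r`. -/
def SkewSol {ι : Type*} [Fintype ι] {A : Type*} [AddCommGroup A] [Module K A]
    (X Y : ι → A) (P Q : ι → ZMod 2) : Prop :=
  (∑ l, gsign K (P l * Q l) • (Y l ⊗ₜ[K] X l)) = -(∑ l, X l ⊗ₜ[K] Y l)

/-- `r = Σ Xₗ ⊗ Yₗ` solves the super Hom-Jordan Yang-Baxter equation
`r₁₂·r₁₃ − r₁₂·r₂₃ + r₁₃·r₂₃ = 0`. -/
def YBESol {ι : Type*} [Fintype ι] {A : Type*} [AddCommGroup A] [Module K A]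
    (mA : A →ₗ[K] A →ₗ[K] A) (γ : A →ₗ[K] A) (X Y : ι → A) (P Q : ι → ZMod 2) : Prop :=
  (∑ l, ∑ l', gsign K (P l' * Q l) • ((mA (X l) (X l') ⊗ₜ[K] γ (Y l)) ⊗ₜ[K] γ (Y l')))
    - (∑ l, ∑ l', (γ (X l) ⊗ₜ[K] mA (Y l) (X l')) ⊗ₜ[K] γ (Y l'))
    + (∑ l, ∑ l', gsign K (P l' * Q l) • ((γ (X l) ⊗ₜ[K] γ (X l')) ⊗ₜ[K] mA (Y l) (Y l')))
    = 0

/-- The left components of the family representing `r = T − σ(T)` in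
`(J ⋉ V*) ⊗ (J ⋉ V*)`, for `T` regarded in `J ⊗ V*` via a homogeneous basis. -/
def rX {n : ℕ} (T : V →ₗ[K] J) (b : Module.Basis (Fin n) K V) (pe : Fin n → ZMod 2) :
    Fin n ⊕ Fin n → J × Module.Dual K V :=
  Sum.elim (fun k => (T (b k), 0))
    (fun k => -(gsign K (pe k * pe k)) • ((0 : J), b.coord k))

/-- The right components of the family representing `r = T − σ(T)`. -/
def rY {n : ℕ} (T : V →ₗ[K] J) (b : Module.Basis (Fin n) K V) :
    Fin n ⊕ Fin n → J × Module.Dual K V :=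
  Sum.elim (fun k => ((0 : J), b.coord k)) (fun k => (T (b k), 0))

/-- The parities of the family representing `r = T − σ(T)`. -/
def rP {n : ℕ} (pe : Fin n → ZMod 2) : Fin n ⊕ Fin n → ZMod 2 := Sum.elim pe pe
theorem gsign_zero' : gsign K 0 = 1 := by simp [gsign]

theorem gsign_one' : gsign K 1 = -1 := by
  have : (1 : ZMod 2).val = 1 := rfl
  simp [gsign, this]

theorem zmod2_cases (p : ZMod 2) : p = 0 ∨ p = 1 := by revert p; decide

theorem zmod2_oneone : (1 : ZMod 2) + 1 = 0 := by decide

theorem hj_I (g : ZMod 2 → Submodule K J)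
    (m : J →ₗ[K] J →ₗ[K] J) (α : J →ₗ[K] J) (hJ : IsMultHomJordan g m α)
    (px py pz pu : ZMod 2) (X : J) (hX : X ∈ g px) (Y : J) (hY : Y ∈ g py)
    (Z : J) (hZ : Z ∈ g pz) (u : J) (hu : u ∈ g pu) :
      m (m (α X) (α Y)) (m (α Z) (α u))
    + gsign K (px * (py + pz)) • m (m (α Y) (α Z)) (m (α X) (α u))
    + gsign K (pz * (px + py)) • m (m (α Z) (α X)) (m (α Y) (α u))
    = m (α (α X)) (m (m Y Z) (α u))
    + gsign K (px * (py + pz)) • m (α (α Y)) (m (m Z X) (α u))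
    + gsign K (pz * (px + py)) • m (α (α Z)) (m (m X Y) (α u)) := by
  obtain ⟨⟨hE, hA, hS, hI⟩, hM⟩ := hJ
  replace hM : ∀ x y : J, α (m x y) = m (α x) (α y) := hM
  have h := hI px py pu pz X hX Y hY u hu Z hZ
  have au := hA _ _ hu
  have a1 := hA _ _ (hA _ _ hX)
  have a2 := hA _ _ (hA _ _ hY)
  have a3 := hA _ _ (hA _ _ hZ)
  simp only [hAss, hM] at h
  rw [hS _ _ _ (hE _ _ _ (hE _ _ _ hX _ hY) _ au) _ a3,
    hS _ _ _ (hE _ _ _ (hE _ _ _ hY _ hZ) _ au) _ a1,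
    hS _ _ _ (hE _ _ _ (hE _ _ _ hZ _ hX) _ au) _ a2,
    hS _ _ _ au _ (hA _ _ hX), hS _ _ _ au _ (hA _ _ hY), hS _ _ _ au _ (hA _ _ hZ)] at h
  clear hX hY hZ hu au a1 a2 a3
  rcases zmod2_cases px with rfl | rfl <;> rcases zmod2_cases py with rfl | rfl <;>
  rcases zmod2_cases pz with rfl | rfl <;> rcases zmod2_cases pu with rfl | rfl <;>
  simp only [mul_zero, zero_mul, mul_one, add_zero, zero_add, zmod2_oneone, gsign_zero',
    gsign_one', map_smul] at h ⊢ <;>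
  first
  | linear_combination (norm := module) h
  | linear_combination (norm := module) (-1 : K) • h

theorem hj_II (g : ZMod 2 → Submodule K J)
    (m : J →ₗ[K] J →ₗ[K] J) (α : J →ₗ[K] J) (hJ : IsMultHomJordan g m α)
    (px py pz pu : ZMod 2) (X : J) (hX : X ∈ g px) (Y : J) (hY : Y ∈ g py)
    (Z : J) (hZ : Z ∈ g pz) (u : J) (hu : u ∈ g pu) :
      m (α (α X)) (m (α Y) (m Z u))
    + gsign K (pz * (px + py) + px * py) • m (α (α Z)) (m (α Y) (m X u))
    + gsign K (py * pz) • m (m (m X Z) (α Y)) (α (α u))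
    = m (α (α X)) (m (m Y Z) (α u))
    + gsign K (px * (py + pz)) • m (α (α Y)) (m (m Z X) (α u))
    + gsign K (pz * (px + py)) • m (α (α Z)) (m (m X Y) (α u)) := by
  rw [← hj_I g m α hJ px py pz pu X hX Y hY Z hZ u hu]
  obtain ⟨⟨hE, hA, hS, hI⟩, hM⟩ := hJ
  replace hM : ∀ x y : J, α (m x y) = m (α x) (α y) := hM
  have h := hI px pz py pu X hX Z hZ Y hY u hu
  have bX := hA _ _ hX
  have bY := hA _ _ hY
  have bZ := hA _ _ hZ
  have bu := hA _ _ hu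
  simp only [hAss, hM] at h
  rw [hS _ _ _ (hE _ _ _ (hE _ _ _ hZ _ hu) _ bY) _ (hA _ _ bX),
    hS _ _ _ (hE _ _ _ (hE _ _ _ hu _ hX) _ bY) _ (hA _ _ bZ),
    hS _ _ _ (hE _ _ _ hZ _ hu) _ bY,
    hS _ _ _ (hE _ _ _ hu _ hX) _ bY,
    hS _ _ _ hu _ hX,
    hS _ _ _ (hE _ _ _ bZ _ bu) _ (hE _ _ _ bY _ bX),
    hS _ _ _ (hE _ _ _ bu _ bX) _ (hE _ _ _ bY _ bZ),
    hS _ _ _ bu _ bX, hS _ _ _ bY _ bX, hS _ _ _ bX _ bZ] at h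
  clear hX hY hZ hu bX bY bZ bu
  rcases zmod2_cases px with rfl | rfl <;> rcases zmod2_cases py with rfl | rfl <;>
  rcases zmod2_cases pz with rfl | rfl <;> rcases zmod2_cases pu with rfl | rfl <;>
  simp only [mul_zero, zero_mul, mul_one, add_zero, zero_add, zmod2_oneone, gsign_zero',
    gsign_one', map_smul, LinearMap.smul_apply] at h ⊢ <;>
  first
  | linear_combination (norm := module) h
  | linear_combination (norm := module) (-1 : K) • h

/-- a Rota-Baxter operator `R` of weight zero on a multiplicative
Hom-Jordan superalgebra `(J, ·, α)` yields a Hom-pre-Jordan superalgebra structure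
`x ∘ y = R(x) · y`. -/
theorem rotaBaxter_to_homPreJordan (g : ZMod 2 → Submodule K J)
    (hg : DirectSum.IsInternal g)
    (m : J →ₗ[K] J →ₗ[K] J) (α : J →ₗ[K] J) (hJ : IsMultHomJordan g m α)
    (R : J →ₗ[K] J) (hRe : EvenMap g R)
    (hRα : ∀ x : J, R (α x) = α (R x))
    (hRB : ∀ x y : J, m (R x) (R y) = R (m (R x) y + m x (R y))) :
    IsHomPreJordan g (m.comp R) α := by
  obtain ⟨⟨hE, hA, hS, hI⟩, hM⟩ := id hJ
  replace hM : ∀ x y : J, α (m x y) = m (α x) (α y) := hM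
  have key : ∀ i j : ZMod 2, ∀ x ∈ g i, ∀ y ∈ g j,
      R (sMul (m.comp R) i j x y) = m (R x) (R y) := by
    intro i j x hx y hy
    rw [hRB, hS i j x hx (R y) (hRe _ _ hy)]
    rfl
  have hc : ∀ x y : J, (m.comp R) x y = m (R x) y := fun _ _ => rfl
  have hsm : ∀ i j : ZMod 2, ∀ x ∈ g i, ∀ y ∈ g j, sMul (m.comp R) i j x y ∈ g (i + j) := by
    intro i j x hx y hy
    refine Submodule.add_mem _ (hE _ _ _ (hRe _ _ hx) _ hy) (Submodule.smul_mem _ _ ?_)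
    rw [add_comm]
    exact hE _ _ _ (hRe _ _ hy) _ hx
  refine ⟨fun i j x hx y hy => hE _ _ _ (hRe _ _ hx) _ hy, hA, fun x y => ?_, ?_, ?_⟩
  · simp only [hc, hM, hRα]
  · intro px py pz pu x hx y hy z hz u hu
    have h := hj_I g m α hJ px py pz pu _ (hRe _ _ hx) _ (hRe _ _ hy) _ (hRe _ _ hz) u hu
    simp only [hc]
    rw [key _ _ _ (hA _ _ hx) _ (hA _ _ hy), key _ _ _ (hA _ _ hy) _ (hA _ _ hz),
      key _ _ _ (hA _ _ hz) _ (hA _ _ hx), key _ _ _ hx _ hy, key _ _ _ hy _ hz,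
      key _ _ _ hz _ hx]
    simp only [hRα]
    exact h
  · intro px py pz pu x hx y hy z hz u hu
    have h := hj_II g m α hJ px py pz pu _ (hRe _ _ hx) _ (hRe _ _ hy) _ (hRe _ _ hz) u hu
    simp only [hc]
    rw [key _ _ _ (hsm _ _ _ hx _ hz) _ (hA _ _ hy), key _ _ _ hx _ hz,
      key _ _ _ hx _ hy, key _ _ _ hy _ hz, key _ _ _ hz _ hx]
    simp only [hRα]
    exact h
end
end

section
/- Let (A, ·, α) be a multiplicative Hom-alternative superalgebra and R : A → A a Rota-Baxter operator of weight 0 (an even linear map with Rα = αR and R(x)·R(y) = R(R(x)·y + x·R(y))). Define x ≺ y = x · R(y) and x ≻ y = R(x) · y. Then (A, ≺, ≻, α) is a Hom-pre-alternative superalgebra. Moreover, R is a Rota-Baxter operator of weight 0 on the associated Hom-Jordan superalgebra (A, ⋆, α), where x ⋆ y = x·y + (-1)^{|x||y|} y·x, and the Hom-pre-Jordan superalgebra associated to this Rota-Baxter operator is (A, ∘, α) with x ∘ y = x ≻ y + (-1)^{|x||y|} y ≺ x. -/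
open scoped TensorProduct

noncomputable section

variable {K : Type*} [Field K] [CharZero K]
variable {J V : Type*} [AddCommGroup J] [Module K J] [AddCommGroup V] [Module K V]

section helpers
variable {F : Type*} [Field F] {M : Type*} [AddCommGroup M] [Module F M]

lemma gsign_pm (e : ZMod 2) : gsign F e = 1 ∨ gsign F e = -1 := by
  unfold gsign; exact neg_one_pow_eq_or F _

lemma gsign_add' (a b : ZMod 2) : gsign F (a + b) = gsign F a * gsign F b := by
  unfold gsign
  rw [← pow_add, ZMod.val_add, ← neg_one_pow_eq_pow_mod_two]

lemma teich (m : M →ₗ[F] M →ₗ[F] M) (α : M →ₗ[F] M) (h : IsMult m α) (a b c d : M) :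
    hAss m α (m a b) (α c) (α d) - hAss m α (α a) (m b c) (α d)
      + hAss m α (α a) (α b) (m c d) - m (α (α a)) (hAss m α b c d)
      - m (hAss m α a b c) (α (α d)) = 0 := by
  simp only [hAss, map_sub, LinearMap.sub_apply, h a b, h c d]
  abel

lemma hAss_add (m : M →ₗ[F] M →ₗ[F] M) (α : M →ₗ[F] M) (a b c d : M) :
    hAss m α (a + b) c d = hAss m α a c d + hAss m α b c d := by
  simp only [hAss, map_add, LinearMap.add_apply]; abel

lemma hAss_smul (m : M →ₗ[F] M →ₗ[F] M) (α : M →ₗ[F] M) (r : F) (a c d : M) :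
    hAss m α (r • a) c d = r • hAss m α a c d := by
  simp only [hAss, map_smul, LinearMap.smul_apply, smul_sub]

variable {g : ZMod 2 → Submodule F M} {m : M →ₗ[F] M →ₗ[F] M} {α : M →ₗ[F] M}

lemma keySum [CharZero F] (hA : IsHomAlternative g m α) (hm : IsMult m α)
    (i j k l : ZMod 2) (x y u z : M) (hx : x ∈ g i) (hy : y ∈ g j) (hu : u ∈ g k)
    (hz : z ∈ g l) :
    gsign F (i * k) • hAss m α (m x y + gsign F (i * j) • m y x) (α u) (α z)
    + gsign F (i * j) • hAss m α (m y u + gsign F (j * k) • m u y) (α x) (α z)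
    + gsign F (j * k) • hAss m α (m u x + gsign F (i * k) • m x u) (α y) (α z) = 0 := by
  obtain ⟨he, hαe, h1, h2⟩ := hA
  have t1 := teich m α hm x y u z
  have t2 := teich m α hm y x u z
  have t3 := teich m α hm x u y z
  have t4 := teich m α hm y u x z
  have t5 := teich m α hm u x y z
  have t6 := teich m α hm u y x z
  have a1 := h1 i j _ (hαe _ _ hx) _ (hαe _ _ hy) (m u z)
  have a2 := h1 j k _ (hαe _ _ hy) _ (hαe _ _ hu) (m x z)
  have a3 := h1 i k _ (hαe _ _ hx) _ (hαe _ _ hu) (m y z)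
  have b1 := congrArg (m (α (α u))) (h1 i j _ hx _ hy z)
  have b2 := congrArg (m (α (α x))) (h1 j k _ hy _ hu z)
  have b3 := congrArg (m (α (α y))) (h1 i k _ hx _ hu z)
  have c1 := congrArg (fun w => m w (α (α z))) (h1 i j _ hx _ hy u)
  have c2 := congrArg (fun w => m w (α (α z))) (h1 j k _ hy _ hu x)
  have c3 := congrArg (fun w => m w (α (α z))) (h1 i k _ hx _ hu y)
  have d1 := h1 i (j + k) _ (hαe _ _ hx) _ (he _ _ _ hy _ hu) (α z)
  have d2 := h1 i (k + j) _ (hαe _ _ hx) _ (he _ _ _ hu _ hy) (α z)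
  have d3 := h1 j (i + k) _ (hαe _ _ hy) _ (he _ _ _ hx _ hu) (α z)
  have d4 := h1 j (k + i) _ (hαe _ _ hy) _ (he _ _ _ hu _ hx) (α z)
  have d5 := h1 k (i + j) _ (hαe _ _ hu) _ (he _ _ _ hx _ hy) (α z)
  have d6 := h1 k (j + i) _ (hαe _ _ hu) _ (he _ _ _ hy _ hx) (α z)
  simp only [map_neg, map_smul, LinearMap.neg_apply, LinearMap.smul_apply,
    mul_add, gsign_add', mul_comm k i, mul_comm k j, mul_comm j i]
    at a1 a2 a3 b1 b2 b3 c1 c2 c3 d1 d2 d3 d4 d5 d6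
  simp only [hAss_add, hAss_smul]
  have hp := gsign_pm (F := F) (i * j)
  have hq := gsign_pm (F := F) (j * k)
  have hr := gsign_pm (F := F) (i * k)
  generalize gsign F (i * j) = p at *
  generalize gsign F (j * k) = q at *
  generalize gsign F (i * k) = r at *
  clear h1 h2
  have fin : ∀ w : M, (2 : F) • w = 0 → w = 0 := fun w hw =>
    (smul_eq_zero.mp hw).resolve_left two_ne_zero
  apply fin
  replace t1 := congrArg (fun w => (r) • w) t1
  replace t2 := congrArg (fun w => (p*r) • w) t2
  replace t3 := congrArg (fun w => (q*r) • w) t3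
  replace t4 := congrArg (fun w => (p) • w) t4
  replace t5 := congrArg (fun w => (q) • w) t5
  replace t6 := congrArg (fun w => (p*q) • w) t6
  replace d1 := congrArg (fun w => (r) • w) d1
  replace d2 := congrArg (fun w => (q*r) • w) d2
  replace d3 := congrArg (fun w => (p*r) • w) d3
  replace d4 := congrArg (fun w => (p) • w) d4
  replace d5 := congrArg (fun w => (q) • w) d5
  replace d6 := congrArg (fun w => (p*q) • w) d6
  replace a1 := congrArg (fun w => (-r) • w) a1
  replace a2 := congrArg (fun w => (-p) • w) a2
  replace a3 := congrArg (fun w => (-(q*r)) • w) a3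
  replace b1 := congrArg (fun w => (q) • w) b1
  replace b2 := congrArg (fun w => (r) • w) b2
  replace b3 := congrArg (fun w => (p*r) • w) b3
  replace c1 := congrArg (fun w => (r) • w) c1
  replace c2 := congrArg (fun w => (p) • w) c2
  replace c3 := congrArg (fun w => (q*r) • w) c3
  rcases hp with rfl | rfl <;> rcases hq with rfl | rfl <;> rcases hr with rfl | rfl <;>
  linear_combination (norm := module) t1 + t2 + t3 + t4 + t5 + t6 + d1 + d2 + d3 + d4 + d5 + d6 + a1 + a2 + a3 + b1 + b2 + b3 + c1 + c2 + c3

lemma brSum (hA : IsHomAlternative g m α)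
    (i j k : ZMod 2) (x y u : M) (hx : x ∈ g i) (hy : y ∈ g j) (hu : u ∈ g k) :
    gsign F (i * k) • (m (m x y + gsign F (i * j) • m y x) (α u)
        - (gsign F (i * k) * gsign F (j * k)) • m (α u) (m x y + gsign F (i * j) • m y x))
    + gsign F (i * j) • (m (m y u + gsign F (j * k) • m u y) (α x)
        - (gsign F (i * j) * gsign F (i * k)) • m (α x) (m y u + gsign F (j * k) • m u y))
    + gsign F (j * k) • (m (m u x + gsign F (i * k) • m x u) (α y)
        - (gsign F (j * k) * gsign F (i * j)) • m (α y) (m u x + gsign F (i * k) • m x u))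
      = 0 := by
  obtain ⟨he, hαe, h1, h2⟩ := hA
  have c1 := h1 i j _ hx _ hy u
  have c2 := h1 j k _ hy _ hu x
  have c3 := h1 i k _ hx _ hu y
  simp only [hAss] at c1 c2 c3
  simp only [map_add, map_smul, LinearMap.add_apply, LinearMap.smul_apply]
  have hp := gsign_pm (F := F) (i * j)
  have hq := gsign_pm (F := F) (j * k)
  have hr := gsign_pm (F := F) (i * k)
  generalize gsign F (i * j) = p at *
  generalize gsign F (j * k) = q at *
  generalize gsign F (i * k) = r at *
  replace c1 := congrArg (fun w => (r) • w) c1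
  replace c2 := congrArg (fun w => (p) • w) c2
  replace c3 := congrArg (fun w => (q*r) • w) c3
  rcases hp with rfl | rfl <;> rcases hq with rfl | rfl <;> rcases hr with rfl | rfl <;>
  linear_combination (norm := module) c1 + c2 + c3

lemma asPlus (hA : IsHomAlternative g m α) (n : M →ₗ[F] M →ₗ[F] M)
    (hn : ∀ i j : ZMod 2, ∀ x ∈ g i, ∀ y ∈ g j, n x y = m x y + gsign F (i * j) • m y x)
    (i j k : ZMod 2) (p z u : M) (hp : p ∈ g i) (hz : z ∈ g j) (hu : u ∈ g k) :
    hAss n α p z u = -((2 : F) • hAss m α p z u)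
      + gsign F (i * j) • m (α z) (m p u - gsign F (i * k) • m u p)
      - gsign F (j * k) • m (m p u - gsign F (i * k) • m u p) (α z) := by
  obtain ⟨he, hαe, h1, h2⟩ := hA
  have hne : ∀ i j : ZMod 2, ∀ x ∈ g i, ∀ y ∈ g j, n x y ∈ g (i + j) := by
    intro i j x hx y hy
    rw [hn i j x hx y hy]
    exact add_mem (he _ _ _ hx _ hy) (Submodule.smul_mem _ _ (add_comm j i ▸ he _ _ _ hy _ hx))
  have e1 := h1 i j _ hp _ hz u
  have e2 := h2 j k _ hz _ hu p
  have e4 := h1 i k _ hp _ hu z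
  have e5 := h1 j k _ hz _ hu p
  have E : hAss n α p z u = n (n p z) (α u) - n (α p) (n z u) := rfl
  rw [E, hn _ _ _ (hne _ _ _ hp _ hz) _ (hαe _ _ hu),
    hn _ _ _ (hαe _ _ hp) _ (hne _ _ _ hz _ hu), hn _ _ _ hp _ hz, hn _ _ _ hz _ hu]
  simp only [hAss] at e1 e2 e4 e5 ⊢
  simp only [map_add, map_sub, map_smul, LinearMap.add_apply, LinearMap.sub_apply,
    LinearMap.smul_apply, mul_add, add_mul, gsign_add']
  have ha := gsign_pm (F := F) (i * j)
  have hb := gsign_pm (F := F) (j * k)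
  have hc := gsign_pm (F := F) (i * k)
  generalize gsign F (i * j) = a at *
  generalize gsign F (j * k) = b at *
  generalize gsign F (i * k) = c at *
  replace e1 := congrArg (fun w => (1 : F) • w) e1
  replace e2 := congrArg (fun w => (2 : F) • w) e2
  replace e4 := congrArg (fun w => (b) • w) e4
  replace e5 := congrArg (fun w => (a*c) • w) e5
  rcases ha with rfl | rfl <;> rcases hb with rfl | rfl <;> rcases hc with rfl | rfl <;>
  linear_combination (norm := module) e1 + e2 - e4 - e5

lemma superComm_star (n : M →ₗ[F] M →ₗ[F] M)
    (hn : ∀ i j : ZMod 2, ∀ x ∈ g i, ∀ y ∈ g j, n x y = m x y + gsign F (i * j) • m y x) :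
    SuperComm g n := by
  intro i j x hx y hy
  rw [hn i j x hx y hy, hn j i y hy x hx, mul_comm j i]
  rcases gsign_pm (F := F) (i * j) with h | h <;> rw [h] <;> module

lemma evenBilin_star (he : EvenBilin g m) (n : M →ₗ[F] M →ₗ[F] M)
    (hn : ∀ i j : ZMod 2, ∀ x ∈ g i, ∀ y ∈ g j, n x y = m x y + gsign F (i * j) • m y x) :
    EvenBilin g n := by
  intro i j x hx y hy
  rw [hn i j x hx y hy]
  exact add_mem (he _ _ _ hx _ hy) (Submodule.smul_mem _ _ (add_comm j i ▸ he _ _ _ hy _ hx))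

set_option maxHeartbeats 4000000 in
lemma homJordan_star [CharZero F] (hA : IsHomAlternative g m α) (hm : IsMult m α)
    (n : M →ₗ[F] M →ₗ[F] M)
    (hn : ∀ i j : ZMod 2, ∀ x ∈ g i, ∀ y ∈ g j, n x y = m x y + gsign F (i * j) • m y x) :
    HomJordanId g n α := by
  intro i j l k x hx y hy z hz u hu
  have hne := evenBilin_star hA.1 n hn
  have hαe := hA.2.1
  have S := keySum hA hm i j k l x y u z hx hy hu hz
  have B := brSum hA i j k x y u hx hy hu
  have J1 := asPlus hA n hn _ _ _ _ _ _ (hne _ _ _ hx _ hy) (hαe _ _ hz) (hαe _ _ hu)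
  have J2 := asPlus hA n hn _ _ _ _ _ _ (hne _ _ _ hy _ hu) (hαe _ _ hz) (hαe _ _ hx)
  have J3 := asPlus hA n hn _ _ _ _ _ _ (hne _ _ _ hu _ hx) (hαe _ _ hz) (hαe _ _ hy)
  have k1 := hA.2.2.2 l k _ (hαe _ _ hz) _ (hαe _ _ hu) (n x y)
  have k2 := hA.2.2.2 l i _ (hαe _ _ hz) _ (hαe _ _ hx) (n y u)
  have k3 := hA.2.2.2 l j _ (hαe _ _ hz) _ (hαe _ _ hy) (n u x)
  have q3 := hn _ _ _ hu _ hx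
  rw [mul_comm k i] at q3
  rw [← hn _ _ _ hx _ hy, ← hn _ _ _ hy _ hu, ← q3] at S B
  have B1 := congrArg (m (α (α z))) B
  have B2 := congrArg (fun w => m w (α (α z))) B
  clear B q3
  rw [J1, J2, J3]
  clear J1 J2 J3
  simp only [map_add, map_sub, map_smul, map_zero, LinearMap.add_apply, LinearMap.sub_apply,
    LinearMap.smul_apply, LinearMap.zero_apply, mul_add, add_mul, gsign_add', mul_comm k i,
    mul_comm k j, mul_comm j i, mul_comm l i, mul_comm l j, mul_comm l k]
    at k1 k2 k3 B1 B2 ⊢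
  have h1 := gsign_pm (F := F) (i * j)
  have h2 := gsign_pm (F := F) (j * k)
  have h3 := gsign_pm (F := F) (i * k)
  have h4 := gsign_pm (F := F) (i * l)
  have h5 := gsign_pm (F := F) (j * l)
  have h6 := gsign_pm (F := F) (k * l)
  generalize hAss m α (n x y) (α z) (α u) = A1 at *
  generalize hAss m α (n y u) (α z) (α x) = A2 at *
  generalize hAss m α (n u x) (α z) (α y) = A3 at *
  generalize gsign F (i * j) = ij at *
  generalize gsign F (j * k) = jk at *
  generalize gsign F (i * k) = ik at *
  generalize gsign F (i * l) = il at *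
  generalize gsign F (j * l) = jl at *
  generalize gsign F (k * l) = kl at *
  replace B1 := congrArg (fun w => (kl * il * jl) • w) B1
  subst k1 k2 k3
  replace S := congrArg (fun w => (2 : F) • w) S
  rcases h1 with rfl | rfl <;> rcases h2 with rfl | rfl <;> rcases h3 with rfl | rfl <;>
  rcases h4 with rfl | rfl <;> rcases h5 with rfl | rfl <;> rcases h6 with rfl | rfl <;>
  linear_combination (norm := module) S + B1 - B2

set_option maxHeartbeats 4000000 in
lemma preJ1 (n : M →ₗ[F] M →ₗ[F] M) (he : EvenBilin g n) (hαe : EvenMap g α)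
    (hc : SuperComm g n) (hm : IsMult n α) (hJ : HomJordanId g n α)
    (i j k l : ZMod 2) (x y z u : M) (hx : x ∈ g i) (hy : y ∈ g j) (hz : z ∈ g k)
    (hu : u ∈ g l) :
    n (n (α x) (α y)) (n (α z) (α u))
    + gsign F (i * (j + k)) • n (n (α y) (α z)) (n (α x) (α u))
    + gsign F (k * (i + j)) • n (n (α z) (α x)) (n (α y) (α u))
    = n (α (α x)) (n (n y z) (α u))
    + gsign F (i * (j + k)) • n (α (α y)) (n (n z x) (α u))
    + gsign F (k * (i + j)) • n (α (α z)) (n (n x y) (α u)) := by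
  have J := hJ i j l k x hx y hy u hu z hz
  have hαα : ∀ a b, b ∈ g a → α (α b) ∈ g a := fun a b h => hαe _ _ (hαe _ _ h)
  have C1 := hc _ _ _ (he _ _ _ (he _ _ _ hx _ hy) _ (hαe _ _ hu)) _ (hαα _ _ hz)
  have C2 := hc _ _ _ (he _ _ _ (he _ _ _ hy _ hz) _ (hαe _ _ hu)) _ (hαα _ _ hx)
  have C3 := hc _ _ _ (he _ _ _ (he _ _ _ hz _ hx) _ (hαe _ _ hu)) _ (hαα _ _ hy)
  have D1 := congrArg (n (n (α x) (α y))) (hc _ _ _ (hαe _ _ hu) _ (hαe _ _ hz))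
  have D2 := congrArg (n (n (α y) (α z))) (hc _ _ _ (hαe _ _ hu) _ (hαe _ _ hx))
  have D3 := congrArg (n (n (α z) (α x))) (hc _ _ _ (hαe _ _ hu) _ (hαe _ _ hy))
  simp only [hAss, hm x y, hm y z, hm z x] at J
  simp only [hAss, map_smul, LinearMap.smul_apply, mul_add, add_mul, gsign_add', mul_comm k i,
    mul_comm k j, mul_comm j i, mul_comm l i, mul_comm l j, mul_comm l k]
    at J C1 C2 C3 D1 D2 D3 ⊢
  have h1 := gsign_pm (F := F) (i * j)
  have h2 := gsign_pm (F := F) (j * k)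
  have h3 := gsign_pm (F := F) (i * k)
  have h4 := gsign_pm (F := F) (i * l)
  have h5 := gsign_pm (F := F) (j * l)
  have h6 := gsign_pm (F := F) (k * l)
  generalize gsign F (i * j) = ij at *
  generalize gsign F (j * k) = jk at *
  generalize gsign F (i * k) = ik at *
  generalize gsign F (i * l) = il at *
  generalize gsign F (j * l) = jl at *
  generalize gsign F (k * l) = kl at *
  rw [C1, C2, C3, D1, D2, D3] at J
  clear C1 C2 C3 D1 D2 D3
  replace J := congrArg (fun w => ik • w) J
  rcases h1 with rfl | rfl <;> rcases h2 with rfl | rfl <;> rcases h3 with rfl | rfl <;>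
  rcases h4 with rfl | rfl <;> rcases h5 with rfl | rfl <;> rcases h6 with rfl | rfl <;>
  linear_combination (norm := module) -J

set_option maxHeartbeats 4000000 in
lemma preJ2 (n : M →ₗ[F] M →ₗ[F] M) (he : EvenBilin g n) (hαe : EvenMap g α)
    (hc : SuperComm g n) (hm : IsMult n α) (hJ : HomJordanId g n α)
    (i j k l : ZMod 2) (x y z u : M) (hx : x ∈ g i) (hy : y ∈ g j) (hz : z ∈ g k)
    (hu : u ∈ g l) :
    n (α (α x)) (n (α y) (n z u))
    + gsign F (k * (i + j) + i * j) • n (α (α z)) (n (α y) (n x u))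
    + gsign F (j * k) • n (n (n x z) (α y)) (α (α u))
    = n (α (α x)) (n (n y z) (α u))
    + gsign F (i * (j + k)) • n (α (α y)) (n (n z x) (α u))
    + gsign F (k * (i + j)) • n (α (α z)) (n (n x y) (α u)) := by
  rw [← preJ1 n he hαe hc hm hJ i j k l x y z u hx hy hz hu]
  have J := hJ i k j l x hx z hz y hy u hu
  have hαα : ∀ a b, b ∈ g a → α (α b) ∈ g a := fun a b h => hαe _ _ (hαe _ _ h)
  have C2 := hc _ _ _ (he _ _ _ (he _ _ _ hz _ hu) _ (hαe _ _ hy)) _ (hαα _ _ hx)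
  have C3 := hc _ _ _ (he _ _ _ (he _ _ _ hu _ hx) _ (hαe _ _ hy)) _ (hαα _ _ hz)
  have C2' := congrArg (n (α (α x))) (hc _ _ _ (he _ _ _ hz _ hu) _ (hαe _ _ hy))
  have C3' := congrArg (n (α (α z))) (hc _ _ _ (he _ _ _ hu _ hx) _ (hαe _ _ hy))
  have C3'' := congrArg (fun w => n (α (α z)) (n (α y) w)) (hc _ _ _ hu _ hx)
  have G1 := congrArg (fun w => n w (n (α y) (α u))) (hc _ _ _ (hαe _ _ hx) _ (hαe _ _ hz))
  have G2 := hc _ _ _ (he _ _ _ (hαe _ _ hz) _ (hαe _ _ hu)) _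
    (he _ _ _ (hαe _ _ hy) _ (hαe _ _ hx))
  have G2' := congrArg (fun w => n w (n (α z) (α u))) (hc _ _ _ (hαe _ _ hy) _ (hαe _ _ hx))
  have G3 := hc _ _ _ (he _ _ _ (hαe _ _ hu) _ (hαe _ _ hx)) _
    (he _ _ _ (hαe _ _ hy) _ (hαe _ _ hz))
  have G3' := congrArg (n (n (α y) (α z))) (hc _ _ _ (hαe _ _ hu) _ (hαe _ _ hx))
  simp only [hAss, hm x z, hm z u, hm u x] at J
  simp only [hAss, map_smul, LinearMap.smul_apply, mul_add, add_mul, gsign_add', mul_comm k i,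
    mul_comm k j, mul_comm j i, mul_comm l i, mul_comm l j, mul_comm l k]
    at J C2 C2' C3 C3' C3'' G1 G2 G2' G3 G3' ⊢
  have h1 := gsign_pm (F := F) (i * j)
  have h2 := gsign_pm (F := F) (j * k)
  have h3 := gsign_pm (F := F) (i * k)
  have h4 := gsign_pm (F := F) (i * l)
  have h5 := gsign_pm (F := F) (j * l)
  have h6 := gsign_pm (F := F) (k * l)
  generalize gsign F (i * j) = ij at *
  generalize gsign F (j * k) = jk at *
  generalize gsign F (i * k) = ik at *
  generalize gsign F (i * l) = il at *
  generalize gsign F (j * l) = jl at *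
  generalize gsign F (k * l) = kl at *
  rw [C2, C2', C3, C3', C3'', G1, G2, G2', G3, G3'] at J
  clear C2 C2' C3 C3' C3'' G1 G2 G2' G3 G3'
  replace J := congrArg (fun w => (jk * il * jl) • w) J
  rcases h1 with rfl | rfl <;> rcases h2 with rfl | rfl <;> rcases h3 with rfl | rfl <;>
  rcases h4 with rfl | rfl <;> rcases h5 with rfl | rfl <;> rcases h6 with rfl | rfl <;>
  linear_combination (norm := module) J

lemma ext_hom (hg : DirectSum.IsInternal g) {f h : M →ₗ[F] M}
    (H : ∀ i, ∀ x ∈ g i, f x = h x) : f = h := by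
  ext x
  have hx : x ∈ ⨆ i, g i := by rw [hg.submodule_iSup_eq_top]; trivial
  induction hx using Submodule.iSup_induction' with
  | mem i x hx => exact H i x hx
  | zero => simp
  | add x y _ _ h1 h2 => simp [h1, h2]

lemma isMult_star (hg : DirectSum.IsInternal g) (hαe : EvenMap g α) (hm : IsMult m α)
    (n : M →ₗ[F] M →ₗ[F] M)
    (hn : ∀ i j : ZMod 2, ∀ x ∈ g i, ∀ y ∈ g j, n x y = m x y + gsign F (i * j) • m y x) :
    IsMult n α := by
  have key : ∀ i, ∀ x ∈ g i, α ∘ₗ n x = n (α x) ∘ₗ α := by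
    intro i x hx
    apply ext_hom hg
    intro j y hy
    simp only [LinearMap.comp_apply]
    rw [hn _ _ _ hx _ hy, hn _ _ _ (hαe _ _ hx) _ (hαe _ _ hy), map_add, map_smul, hm, hm]
  intro x y
  have : α ∘ₗ n.flip y = (n.flip (α y)) ∘ₗ α := by
    apply ext_hom hg
    intro i x hx
    exact LinearMap.congr_fun (key i x hx) y
  exact LinearMap.congr_fun this x
end helpers

/-- a Rota-Baxter operator `R` of weight `0` on a multiplicative
Hom-alternative superalgebra `(A, ·, α)` gives a Hom-pre-alternative superalgebra via
`x ≺ y = x·R(y)`, `x ≻ y = R(x)·y`; moreover `R` is a Rota-Baxter operator of weight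
`0` on the associated Hom-Jordan superalgebra `(A, ⋆, α)`, its associated
Hom-pre-Jordan superalgebra `x ∘ y = R(x) ⋆ y` is a Hom-pre-Jordan structure,
and `x ∘ y = x ≻ y + (-1)^{|x||y|} y ≺ x`. -/
theorem rotaBaxter_homAlternative (g : ZMod 2 → Submodule K J)
    (hg : DirectSum.IsInternal g)
    (m : J →ₗ[K] J →ₗ[K] J) (α : J →ₗ[K] J)
    (hAlt : IsHomAlternative g m α) (hmult : IsMult m α)
    (R : J →ₗ[K] J) (hRe : EvenMap g R)
    (hRα : ∀ x : J, R (α x) = α (R x))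
    (hRB : ∀ x y : J, m (R x) (R y) = R (m (R x) y + m x (R y)))
    (mstar : J →ₗ[K] J →ₗ[K] J)
    (hmstar : ∀ i j : ZMod 2, ∀ x ∈ g i, ∀ y ∈ g j,
      mstar x y = m x y + gsign K (i * j) • m y x) :
    IsHomPreAlternative g (((m.flip).comp R).flip) (m.comp R) α ∧
    (∀ i j : ZMod 2, ∀ x ∈ g i, ∀ y ∈ g j,
      mstar (R x) (R y) = R (mstar (R x) y + mstar x (R y))) ∧
    IsHomPreJordan g (mstar.comp R) α ∧
    (∀ i j : ZMod 2, ∀ x ∈ g i, ∀ y ∈ g j,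
      (mstar.comp R) x y
        = (m.comp R) x y + gsign K (i * j) • (((m.flip).comp R).flip) y x) := by
  obtain ⟨he, hαe, h1, h2⟩ := id hAlt
  have hne := evenBilin_star he mstar hmstar
  have hnc := superComm_star mstar hmstar
  have hnm := isMult_star hg hαe hmult mstar hmstar
  have hJ := homJordan_star hAlt hmult mstar hmstar
  have hP : ∀ x y, (((m.flip).comp R).flip) x y = m x (R y) := fun _ _ => rfl
  have hS : ∀ x y, (m.comp R) x y = m (R x) y := fun _ _ => rfl
  have hC : ∀ x y, (mstar.comp R) x y = mstar (R x) y := fun _ _ => rfl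
  have hRs : ∀ i j : ZMod 2, ∀ x ∈ g i, ∀ y ∈ g j,
      mstar (R x) (R y) = R (mstar (R x) y + mstar x (R y)) := by
    intro i j x hx y hy
    rw [hmstar _ _ _ (hRe _ _ hx) _ (hRe _ _ hy), hmstar _ _ _ (hRe _ _ hx) _ hy,
      hmstar _ _ _ hx _ (hRe _ _ hy), hRB, hRB]
    simp only [map_add, map_smul]
    module
  have hRM : ∀ i j : ZMod 2, ∀ x ∈ g i, ∀ y ∈ g j,
      R (sMul (mstar.comp R) i j x y) = mstar (R x) (R y) := by
    intro i j x hx y hy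
    rw [hRs i j x hx y hy, hnc i j x hx (R y) (hRe _ _ hy)]
    rfl
  have hsm : ∀ i j : ZMod 2, ∀ x ∈ g i, ∀ y ∈ g j,
      sMul (mstar.comp R) i j x y ∈ g (i + j) := by
    intro i j x hx y hy
    exact add_mem (hne _ _ _ (hRe _ _ hx) _ hy)
      (Submodule.smul_mem _ _ (add_comm j i ▸ hne _ _ _ (hRe _ _ hy) _ hx))
  have aL : ∀ x y z, passL (((m.flip).comp R).flip) (m.comp R) α x y z
      = hAss m α (R x) (R y) z := by
    intro x y z
    simp only [passL, hAss, hP, hS, hRα, hRB x y, add_comm]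
  have aM : ∀ x y z, passM (((m.flip).comp R).flip) (m.comp R) α x y z
      = hAss m α (R x) y (R z) := by
    intro x y z
    simp only [passM, hAss, hP, hS, hRα]
  have aR : ∀ x y z, passR (((m.flip).comp R).flip) (m.comp R) α x y z
      = hAss m α x (R y) (R z) := by
    intro x y z
    simp only [passR, hAss, hP, hS, hRα, hRB y z, add_comm]
  refine ⟨⟨?_, ?_, hαe, ?_, ?_, ?_, ?_⟩, hRs, ⟨?_, hαe, ?_, ?_, ?_⟩, ?_⟩
  · intro i j x hx y hy
    exact he _ _ _ hx _ (hRe _ _ hy)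
  · intro i j x hx y hy
    exact he _ _ _ (hRe _ _ hx) _ hy
  · intro i j x hx y hy z
    rw [aM, aR, h1 _ _ _ (hRe _ _ hx) _ hy]; abel
  · intro j k y hy z hz x
    rw [aM, aL, h2 _ _ _ hy _ (hRe _ _ hz)]; abel
  · intro i j x hx y hy z
    rw [aL, aL, h1 _ _ _ (hRe _ _ hx) _ (hRe _ _ hy)]; abel
  · intro j k y hy z hz x
    rw [aR, aR, h2 _ _ _ (hRe _ _ hy) _ (hRe _ _ hz)]; abel
  · intro i j x hx y hy
    exact hne _ _ _ (hRe _ _ hx) _ hy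
  · intro x y
    rw [hC, hC, hnm, hRα]
  · intro i j k l x hx y hy z hz u hu
    have := preJ1 mstar hne hαe hnc hnm hJ i j k l (R x) (R y) (R z) u (hRe _ _ hx) (hRe _ _ hy)
      (hRe _ _ hz) hu
    simp only [hC]
    rw [hRM _ _ _ (hαe _ _ hx) _ (hαe _ _ hy), hRM _ _ _ (hαe _ _ hy) _ (hαe _ _ hz),
      hRM _ _ _ (hαe _ _ hz) _ (hαe _ _ hx), hRM _ _ _ hx _ hy, hRM _ _ _ hy _ hz,
      hRM _ _ _ hz _ hx]
    simp only [hRα]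
    exact this
  · intro i j k l x hx y hy z hz u hu
    have := preJ2 mstar hne hαe hnc hnm hJ i j k l (R x) (R y) (R z) u (hRe _ _ hx) (hRe _ _ hy)
      (hRe _ _ hz) hu
    simp only [hC]
    rw [hRM _ _ _ (hsm _ _ _ hx _ hz) _ (hαe _ _ hy), hRM _ _ _ hx _ hz, hRM _ _ _ hx _ hy,
      hRM _ _ _ hy _ hz, hRM _ _ _ hz _ hx]
    simp only [hRα]
    exact this
  · intro i j x hx y hy
    rw [hC, hS, hP, hmstar _ _ _ (hRe _ _ hx) _ hy]
end
end
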